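/- arXiv:2503.10782 — 12 statements merged into one kernel-verified Lean document; each statement's English description precedes it below -/
import Mathlib

section
/- Suppose the real parameters satisfy p₁ + q₁ + r₁ = 0. If x₁, x₂, x₃ : ℝ → ℝ are differentiable and satisfy for all t: x₁' = p₁x₂x₃ + b₁x₃ − c₁x₂, x₂' = q₁x₃x₁ + c₁x₁ − a₁x₃, x₃' = r₁x₁x₂ + a₁x₂ − b₁x₁, then the Casimir function t ↦ −(q₁/2)x₁(t)² + (p₁/2)x₂(t)² + a₁x₁(t) + b₁x₂(t) + c₁x₃(t) is constant on ℝ. -/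
/-- For the single Volterra gyrostat with p₁ + q₁ + r₁ = 0,
the Casimir −(q₁/2)x₁² + (p₁/2)x₂² + a₁x₁ + b₁x₂ + c₁x₃ is conserved. -/
theorem gyrostat_casimir_conserved
    (a₁ b₁ c₁ p₁ q₁ r₁ : ℝ) (hsum : p₁ + q₁ + r₁ = 0)
    (x₁ x₂ x₃ : ℝ → ℝ)
    (hx₁ : Differentiable ℝ x₁) (hx₂ : Differentiable ℝ x₂) (hx₃ : Differentiable ℝ x₃)
    (h₁ : ∀ t, deriv x₁ t = p₁ * x₂ t * x₃ t + b₁ * x₃ t - c₁ * x₂ t)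
    (h₂ : ∀ t, deriv x₂ t = q₁ * x₃ t * x₁ t + c₁ * x₁ t - a₁ * x₃ t)
    (h₃ : ∀ t, deriv x₃ t = r₁ * x₁ t * x₂ t + a₁ * x₂ t - b₁ * x₁ t) :
    ∀ s t : ℝ,
      -(q₁ / 2) * x₁ s ^ 2 + (p₁ / 2) * x₂ s ^ 2 + a₁ * x₁ s + b₁ * x₂ s + c₁ * x₃ s
        = -(q₁ / 2) * x₁ t ^ 2 + (p₁ / 2) * x₂ t ^ 2 + a₁ * x₁ t + b₁ * x₂ t + c₁ * x₃ t := by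
  have key : ∀ t, HasDerivAt (fun t => -(q₁ / 2) * x₁ t ^ 2 + (p₁ / 2) * x₂ t ^ 2
      + a₁ * x₁ t + b₁ * x₂ t + c₁ * x₃ t) 0 t := by
    intro t
    have d₁ := (hx₁ t).hasDerivAt
    have d₂ := (hx₂ t).hasDerivAt
    have d₃ := (hx₃ t).hasDerivAt
    rw [h₁ t] at d₁
    rw [h₂ t] at d₂
    rw [h₃ t] at d₃
    refine HasDerivAt.congr_deriv (((((d₁.fun_pow 2).const_mul (-(q₁ / 2))).fun_add
      ((d₂.fun_pow 2).const_mul (p₁ / 2))).fun_add (d₁.const_mul a₁)).fun_add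
      (d₂.const_mul b₁) |>.fun_add (d₃.const_mul c₁)) ?_
    norm_num
    linear_combination (c₁ * x₁ t * x₂ t) * hsum
  exact is_const_of_deriv_eq_zero (fun t => (key t).differentiableAt) (fun t => (key t).deriv)
end

section
/- Let J : ℝ³ → Matrix (Fin 3) (Fin 3) ℝ be defined by J(x)₁₂ = −c₁, J(x)₁₃ = p₁x₂ + b₁, J(x)₂₃ = q₁x₁ − a₁, with zero diagonal and J(x)ⱼᵢ = −J(x)ᵢⱼ. Then for all indices i, j, k ∈ Fin 3 and all x ∈ ℝ³, the cyclic sum Σₘ [J(x)ᵢₘ · ∂J(·)ⱼₖ/∂xₘ(x) + J(x)ⱼₘ · ∂J(·)ₖᵢ/∂xₘ(x) + J(x)ₖₘ · ∂J(·)ᵢⱼ/∂xₘ(x)] equals 0; i.e. the single-gyrostat symplectic matrix satisfies the Jacobi identity, making the single Volterra gyrostat a non-canonical Hamiltonian system. -/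
/-- The symplectic matrix of the single Volterra gyrostat. -/
def gyroJ (a₁ b₁ c₁ p₁ q₁ : ℝ) (x : Fin 3 → ℝ) : Matrix (Fin 3) (Fin 3) ℝ :=
  !![0, -c₁, p₁ * x 1 + b₁;
     c₁, 0, q₁ * x 0 - a₁;
     -(p₁ * x 1 + b₁), -(q₁ * x 0 - a₁), 0]

/-- The derivative of each (affine) entry is its linear part. -/
theorem gyroJ_fderiv (a₁ b₁ c₁ p₁ q₁ : ℝ) (j k : Fin 3) (x v : Fin 3 → ℝ) :
    fderiv ℝ (fun y => gyroJ a₁ b₁ c₁ p₁ q₁ y j k) x v = gyroJ 0 0 0 p₁ q₁ v j k := by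
  have h0 : HasFDerivAt (fun y : Fin 3 → ℝ => q₁ * y 0 - a₁)
      (q₁ • (ContinuousLinearMap.proj 0 : (Fin 3 → ℝ) →L[ℝ] ℝ)) x :=
    ((hasFDerivAt_apply (0 : Fin 3) x).const_mul q₁).sub_const a₁
  have h1 : HasFDerivAt (fun y : Fin 3 → ℝ => p₁ * y 1 + b₁)
      (p₁ • (ContinuousLinearMap.proj 1 : (Fin 3 → ℝ) →L[ℝ] ℝ)) x :=
    ((hasFDerivAt_apply (1 : Fin 3) x).const_mul p₁).add_const b₁
  have e0 := h0.fderiv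
  have e1 := h1.fderiv
  have e2 := h0.fun_neg.fderiv
  have e3 := h1.fun_neg.fderiv
  fin_cases j <;> fin_cases k <;>
    simp [gyroJ, e0, e1, -neg_add_rev, -neg_sub, -fderiv_fun_neg, e2, e3,
      -fderiv_add_const, -fderiv_sub_const]

/-- The single-gyrostat symplectic matrix satisfies the Jacobi identity. -/
theorem gyroJ_jacobi_identity (a₁ b₁ c₁ p₁ q₁ : ℝ) :
    ∀ (i j k : Fin 3) (x : Fin 3 → ℝ),
      ∑ m : Fin 3,
        (gyroJ a₁ b₁ c₁ p₁ q₁ x i m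
            * fderiv ℝ (fun y => gyroJ a₁ b₁ c₁ p₁ q₁ y j k) x (Pi.single m 1)
          + gyroJ a₁ b₁ c₁ p₁ q₁ x j m
            * fderiv ℝ (fun y => gyroJ a₁ b₁ c₁ p₁ q₁ y k i) x (Pi.single m 1)
          + gyroJ a₁ b₁ c₁ p₁ q₁ x k m
            * fderiv ℝ (fun y => gyroJ a₁ b₁ c₁ p₁ q₁ y i j) x (Pi.single m 1)) = 0 := by
  intro i j k x
  simp only [gyroJ_fderiv, Fin.sum_univ_three]
  fin_cases i <;> fin_cases j <;> fin_cases k <;> simp [gyroJ]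
end

section
/- Suppose the real parameters satisfy p₁ + q₁ + r₁ = 0 and p₂ + q₂ + r₂ = 0. If x₁, x₂, x₃, x₄ : ℝ → ℝ are differentiable and satisfy the Model 1 equations for all t, then the energy t ↦ (1/2)(x₁(t)² + x₂(t)² + x₃(t)² + x₄(t)²) is constant on ℝ. -/
/-- Energy conservation for Model 1 (M = 4 modes, K = 2 gyrostats). -/
theorem model1_energy_conserved
    (a₁ b₁ c₁ p₁ q₁ r₁ a₂ b₂ c₂ p₂ q₂ r₂ : ℝ)
    (hsum₁ : p₁ + q₁ + r₁ = 0) (hsum₂ : p₂ + q₂ + r₂ = 0)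
    (x₁ x₂ x₃ x₄ : ℝ → ℝ)
    (hx₁ : Differentiable ℝ x₁) (hx₂ : Differentiable ℝ x₂)
    (hx₃ : Differentiable ℝ x₃) (hx₄ : Differentiable ℝ x₄)
    (h₁ : ∀ t, deriv x₁ t = p₁ * x₂ t * x₃ t + b₁ * x₃ t - c₁ * x₂ t)
    (h₂ : ∀ t, deriv x₂ t = q₁ * x₃ t * x₁ t + c₁ * x₁ t - a₁ * x₃ t
      + p₂ * x₃ t * x₄ t + b₂ * x₄ t - c₂ * x₃ t)
    (h₃ : ∀ t, deriv x₃ t = r₁ * x₁ t * x₂ t + a₁ * x₂ t - b₁ * x₁ t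
      + q₂ * x₄ t * x₂ t + c₂ * x₂ t - a₂ * x₄ t)
    (h₄ : ∀ t, deriv x₄ t = r₂ * x₂ t * x₃ t + a₂ * x₃ t - b₂ * x₂ t) :
    ∀ s t : ℝ, (1 / 2) * (x₁ s ^ 2 + x₂ s ^ 2 + x₃ s ^ 2 + x₄ s ^ 2)
      = (1 / 2) * (x₁ t ^ 2 + x₂ t ^ 2 + x₃ t ^ 2 + x₄ t ^ 2) := by
  have hE : ∀ t, HasDerivAt
      (fun u => (1 / 2) * (x₁ u ^ 2 + x₂ u ^ 2 + x₃ u ^ 2 + x₄ u ^ 2)) 0 t := by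
    intro t
    have d₁ := (hx₁ t).hasDerivAt.fun_pow 2
    have d₂ := (hx₂ t).hasDerivAt.fun_pow 2
    have d₃ := (hx₃ t).hasDerivAt.fun_pow 2
    have d₄ := (hx₄ t).hasDerivAt.fun_pow 2
    have d := (((d₁.fun_add d₂).fun_add d₃).fun_add d₄).const_mul (1 / 2 : ℝ)
    refine d.congr_deriv ?_
    rw [h₁, h₂, h₃, h₄]
    push_cast
    linear_combination (x₁ t * x₂ t * x₃ t) * hsum₁ + (x₂ t * x₃ t * x₄ t) * hsum₂
  exact is_const_of_deriv_eq_zero (fun t => (hE t).differentiableAt) (fun t => (hE t).deriv)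
end

section
/- Suppose the real parameters satisfy p₁ + q₁ + r₁ = 0 and p₂ + q₂ + r₂ = 0. If x₁, x₂, x₃, x₄, x₅ : ℝ → ℝ are differentiable and satisfy the Model 2 equations for all t, then the energy t ↦ (1/2)(x₁(t)² + x₂(t)² + x₃(t)² + x₄(t)² + x₅(t)²) is constant on ℝ. -/
/-- Energy conservation for Model 2 (M = 5 modes, K = 2 gyrostats). -/
theorem model2_energy_conserved
    (a₁ b₁ c₁ p₁ q₁ r₁ a₂ b₂ c₂ p₂ q₂ r₂ : ℝ)
    (hsum₁ : p₁ + q₁ + r₁ = 0) (hsum₂ : p₂ + q₂ + r₂ = 0)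
    (x₁ x₂ x₃ x₄ x₅ : ℝ → ℝ)
    (hx₁ : Differentiable ℝ x₁) (hx₂ : Differentiable ℝ x₂)
    (hx₃ : Differentiable ℝ x₃) (hx₄ : Differentiable ℝ x₄)
    (hx₅ : Differentiable ℝ x₅)
    (h₁ : ∀ t, deriv x₁ t = p₁ * x₂ t * x₃ t + b₁ * x₃ t - c₁ * x₂ t)
    (h₂ : ∀ t, deriv x₂ t = q₁ * x₃ t * x₁ t + c₁ * x₁ t - a₁ * x₃ t)
    (h₃ : ∀ t, deriv x₃ t = r₁ * x₁ t * x₂ t + a₁ * x₂ t - b₁ * x₁ t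
      + p₂ * x₄ t * x₅ t + b₂ * x₅ t - c₂ * x₄ t)
    (h₄ : ∀ t, deriv x₄ t = q₂ * x₅ t * x₃ t + c₂ * x₃ t - a₂ * x₅ t)
    (h₅ : ∀ t, deriv x₅ t = r₂ * x₃ t * x₄ t + a₂ * x₄ t - b₂ * x₃ t) :
    ∀ s t : ℝ, (1 / 2) * (x₁ s ^ 2 + x₂ s ^ 2 + x₃ s ^ 2 + x₄ s ^ 2 + x₅ s ^ 2)
      = (1 / 2) * (x₁ t ^ 2 + x₂ t ^ 2 + x₃ t ^ 2 + x₄ t ^ 2 + x₅ t ^ 2) := by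
  have key : ∀ t, HasDerivAt (fun t => (1 / 2 : ℝ) *
      (x₁ t ^ 2 + x₂ t ^ 2 + x₃ t ^ 2 + x₄ t ^ 2 + x₅ t ^ 2)) 0 t := by
    intro t
    have d := ((((((hx₁ t).hasDerivAt.fun_pow 2).fun_add ((hx₂ t).hasDerivAt.fun_pow 2)).fun_add
      ((hx₃ t).hasDerivAt.fun_pow 2)).fun_add ((hx₄ t).hasDerivAt.fun_pow 2)).fun_add
      ((hx₅ t).hasDerivAt.fun_pow 2)).const_mul (1 / 2 : ℝ)
    refine d.congr_deriv ?_
    rw [h₁, h₂, h₃, h₄, h₅]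
    norm_num
    linear_combination (2 * x₁ t * x₂ t * x₃ t) * hsum₁ + (2 * x₃ t * x₄ t * x₅ t) * hsum₂
  intro s t
  exact is_const_of_deriv_eq_zero (fun t => (key t).differentiableAt)
    (fun t => (key t).deriv) s t
end

section
/- If x₁, x₂, x₃, x₄ : ℝ → ℝ are differentiable and satisfy for all t: x₁' = p₁x₂x₃; x₂' = q₁x₃x₁ − a₁x₃ + p₂x₃x₄ − c₂x₃; x₃' = r₁x₁x₂ + a₁x₂ + q₂x₄x₂ + c₂x₂; x₄' = r₂x₂x₃, then the function t ↦ r₂x₁(t) − p₁x₄(t) is constant on ℝ; in particular the components x₁' and x₄' of the vector field are linearly dependent. -/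
/-- In the subclass of Model 1 with b₁ = c₁ = a₂ = b₂ = 0, the function
r₂x₁ − p₁x₄ is constant; in particular x₁' and x₄' are linearly dependent. -/
theorem model1_subclass_linear_dependence
    (a₁ c₂ p₁ q₁ r₁ p₂ q₂ r₂ : ℝ)
    (x₁ x₂ x₃ x₄ : ℝ → ℝ)
    (hx₁ : Differentiable ℝ x₁) (hx₂ : Differentiable ℝ x₂)
    (hx₃ : Differentiable ℝ x₃) (hx₄ : Differentiable ℝ x₄)
    (h₁ : ∀ t, deriv x₁ t = p₁ * x₂ t * x₃ t)
    (h₂ : ∀ t, deriv x₂ t = q₁ * x₃ t * x₁ t - a₁ * x₃ t + p₂ * x₃ t * x₄ t - c₂ * x₃ t)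
    (h₃ : ∀ t, deriv x₃ t = r₁ * x₁ t * x₂ t + a₁ * x₂ t + q₂ * x₄ t * x₂ t + c₂ * x₂ t)
    (h₄ : ∀ t, deriv x₄ t = r₂ * x₂ t * x₃ t) :
    (∀ s t : ℝ, r₂ * x₁ s - p₁ * x₄ s = r₂ * x₁ t - p₁ * x₄ t) ∧
    (∀ t : ℝ, r₂ * deriv x₁ t = p₁ * deriv x₄ t) := by
  have key : ∀ t : ℝ, r₂ * deriv x₁ t = p₁ * deriv x₄ t := by
    intro t
    rw [h₁, h₄]
    ring
  refine ⟨?_, key⟩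
  have hd : ∀ t, HasDerivAt (fun t => r₂ * x₁ t - p₁ * x₄ t) 0 t := by
    intro t
    have h := ((hx₁ t).hasDerivAt.const_mul r₂).sub ((hx₄ t).hasDerivAt.const_mul p₁)
    rw [key t, sub_self] at h
    exact h
  exact is_const_of_deriv_eq_zero (fun t => (hd t).differentiableAt) (fun t => (hd t).deriv)
end

section
/- Suppose p₁ + q₁ + r₁ = 0, p₂ + q₂ + r₂ = 0 and r₂ ≠ 0. If x₁, x₂, x₃, x₄ : ℝ → ℝ are differentiable and satisfy for all t: x₁' = p₁x₂x₃; x₂' = q₁x₃x₁ + p₂x₃x₄; x₃' = r₁x₁x₂ + q₂x₄x₂; x₄' = r₂x₂x₃, then each of the following three functions is constant on ℝ: (i) t ↦ (x₁ − (p₁/r₂)x₄)², (ii) t ↦ x₂²/2 − ((p₂ − p₁q₁/r₂)/(2r₂))x₄² − (q₁/r₂)x₁x₄, (iii) t ↦ x₃²/2 − ((q₂ − p₁r₁/r₂)/(2r₂))x₄² − (r₁/r₂)x₁x₄; hence this system possesses three independent quadratic invariants. -/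
/-- Model 1 without linear feedbacks possesses three independent quadratic
invariants. -/
theorem model1_no_linear_feedback_three_invariants
    (p₁ q₁ r₁ p₂ q₂ r₂ : ℝ)
    (hsum₁ : p₁ + q₁ + r₁ = 0) (hsum₂ : p₂ + q₂ + r₂ = 0) (hr₂ : r₂ ≠ 0)
    (x₁ x₂ x₃ x₄ : ℝ → ℝ)
    (hx₁ : Differentiable ℝ x₁) (hx₂ : Differentiable ℝ x₂)
    (hx₃ : Differentiable ℝ x₃) (hx₄ : Differentiable ℝ x₄)
    (h₁ : ∀ t, deriv x₁ t = p₁ * x₂ t * x₃ t)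
    (h₂ : ∀ t, deriv x₂ t = q₁ * x₃ t * x₁ t + p₂ * x₃ t * x₄ t)
    (h₃ : ∀ t, deriv x₃ t = r₁ * x₁ t * x₂ t + q₂ * x₄ t * x₂ t)
    (h₄ : ∀ t, deriv x₄ t = r₂ * x₂ t * x₃ t) :
    (∀ s t : ℝ,
      (x₁ s - (p₁ / r₂) * x₄ s) ^ 2 = (x₁ t - (p₁ / r₂) * x₄ t) ^ 2) ∧
    (∀ s t : ℝ,
      x₂ s ^ 2 / 2 - ((p₂ - p₁ * q₁ / r₂) / (2 * r₂)) * x₄ s ^ 2 - (q₁ / r₂) * x₁ s * x₄ s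
        = x₂ t ^ 2 / 2 - ((p₂ - p₁ * q₁ / r₂) / (2 * r₂)) * x₄ t ^ 2
          - (q₁ / r₂) * x₁ t * x₄ t) ∧
    (∀ s t : ℝ,
      x₃ s ^ 2 / 2 - ((q₂ - p₁ * r₁ / r₂) / (2 * r₂)) * x₄ s ^ 2 - (r₁ / r₂) * x₁ s * x₄ s
        = x₃ t ^ 2 / 2 - ((q₂ - p₁ * r₁ / r₂) / (2 * r₂)) * x₄ t ^ 2
          - (r₁ / r₂) * x₁ t * x₄ t) := by
  have d₁ : ∀ t, HasDerivAt x₁ (p₁ * x₂ t * x₃ t) t := fun t => h₁ t ▸ (hx₁ t).hasDerivAt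
  have d₂ : ∀ t, HasDerivAt x₂ (q₁ * x₃ t * x₁ t + p₂ * x₃ t * x₄ t) t :=
    fun t => h₂ t ▸ (hx₂ t).hasDerivAt
  have d₃ : ∀ t, HasDerivAt x₃ (r₁ * x₁ t * x₂ t + q₂ * x₄ t * x₂ t) t :=
    fun t => h₃ t ▸ (hx₃ t).hasDerivAt
  have d₄ : ∀ t, HasDerivAt x₄ (r₂ * x₂ t * x₃ t) t := fun t => h₄ t ▸ (hx₄ t).hasDerivAt
  have key : ∀ f : ℝ → ℝ, (∀ t, HasDerivAt f 0 t) → ∀ s t, f s = f t := fun f hf =>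
    is_const_of_deriv_eq_zero (fun t => (hf t).differentiableAt) (fun t => (hf t).deriv)
  refine ⟨?_, ?_, ?_⟩
  · refine key (fun t => (x₁ t - (p₁ / r₂) * x₄ t) ^ 2) fun t => ?_
    refine (((d₁ t).sub ((d₄ t).const_mul (p₁ / r₂))).pow 2).congr_deriv ?_
    field_simp
    ring
  · refine key (fun t => x₂ t ^ 2 / 2 - ((p₂ - p₁ * q₁ / r₂) / (2 * r₂)) * x₄ t ^ 2
      - (q₁ / r₂) * x₁ t * x₄ t) fun t => ?_
    refine (((((d₂ t).pow 2).div_const 2).sub (((d₄ t).pow 2).const_mul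
      ((p₂ - p₁ * q₁ / r₂) / (2 * r₂)))).sub
      (((d₁ t).const_mul (q₁ / r₂)).mul (d₄ t))).congr_deriv ?_
    field_simp
    ring
  · refine key (fun t => x₃ t ^ 2 / 2 - ((q₂ - p₁ * r₁ / r₂) / (2 * r₂)) * x₄ t ^ 2
      - (r₁ / r₂) * x₁ t * x₄ t) fun t => ?_
    refine (((((d₃ t).pow 2).div_const 2).sub (((d₄ t).pow 2).const_mul
      ((q₂ - p₁ * r₁ / r₂) / (2 * r₂)))).sub
      (((d₁ t).const_mul (r₁ / r₂)).mul (d₄ t))).congr_deriv ?_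
    field_simp
    ring
end

section
/- Suppose p₁ + q₁ + r₁ = 0, p₂ + q₂ + r₂ = 0, p₁ ≠ 0 and p₂ ≠ 0. If x₁, x₂, x₃, x₄, x₅ : ℝ → ℝ are differentiable and satisfy for all t: x₁' = p₁x₂x₃; x₂' = q₁x₃x₁; x₃' = r₁x₁x₂ + p₂x₄x₅; x₄' = q₂x₅x₃; x₅' = r₂x₃x₄, then each of the following functions is constant on ℝ: (i) t ↦ −(q₁/p₁)x₁² + x₂², (ii) t ↦ (q₂r₁/(p₁p₂))x₁² − (q₂/p₂)x₃² + x₄², (iii) t ↦ (r₁r₂/(p₁p₂))x₁² − (r₂/p₂)x₃² + x₅². -/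
/-- A diagonal quadratic form whose derivative along the flow vanishes is constant. -/
lemma quad_const (a b c : ℝ) (x y z : ℝ → ℝ) (hx : Differentiable ℝ x)
    (hy : Differentiable ℝ y) (hz : Differentiable ℝ z)
    (h : ∀ t, a * (x t * deriv x t) + b * (y t * deriv y t) + c * (z t * deriv z t) = 0)
    (s t : ℝ) :
    a * x s ^ 2 + b * y s ^ 2 + c * z s ^ 2 = a * x t ^ 2 + b * y t ^ 2 + c * z t ^ 2 := by
  have key : ∀ u, HasDerivAt (fun u => a * x u ^ 2 + b * y u ^ 2 + c * z u ^ 2) 0 u := by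
    intro u
    have h1 := (((hx u).hasDerivAt.fun_pow 2).const_mul a).fun_add
      (((hy u).hasDerivAt.fun_pow 2).const_mul b)
    have h2 := h1.fun_add (((hz u).hasDerivAt.fun_pow 2).const_mul c)
    refine h2.congr_deriv ?_
    have := h u
    norm_num
    linear_combination 2 * this
  exact is_const_of_deriv_eq_zero (fun u => (key u).differentiableAt)
    (fun u => (key u).deriv) s t

/-- Model 2 without linear feedbacks possesses three quadratic invariants. -/
theorem model2_no_linear_feedback_three_invariants
    (p₁ q₁ r₁ p₂ q₂ r₂ : ℝ)
    (hsum₁ : p₁ + q₁ + r₁ = 0) (hsum₂ : p₂ + q₂ + r₂ = 0)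
    (hp₁ : p₁ ≠ 0) (hp₂ : p₂ ≠ 0)
    (x₁ x₂ x₃ x₄ x₅ : ℝ → ℝ)
    (hx₁ : Differentiable ℝ x₁) (hx₂ : Differentiable ℝ x₂)
    (hx₃ : Differentiable ℝ x₃) (hx₄ : Differentiable ℝ x₄)
    (hx₅ : Differentiable ℝ x₅)
    (h₁ : ∀ t, deriv x₁ t = p₁ * x₂ t * x₃ t)
    (h₂ : ∀ t, deriv x₂ t = q₁ * x₃ t * x₁ t)
    (h₃ : ∀ t, deriv x₃ t = r₁ * x₁ t * x₂ t + p₂ * x₄ t * x₅ t)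
    (h₄ : ∀ t, deriv x₄ t = q₂ * x₅ t * x₃ t)
    (h₅ : ∀ t, deriv x₅ t = r₂ * x₃ t * x₄ t) :
    (∀ s t : ℝ,
      -(q₁ / p₁) * x₁ s ^ 2 + x₂ s ^ 2 = -(q₁ / p₁) * x₁ t ^ 2 + x₂ t ^ 2) ∧
    (∀ s t : ℝ,
      (q₂ * r₁ / (p₁ * p₂)) * x₁ s ^ 2 - (q₂ / p₂) * x₃ s ^ 2 + x₄ s ^ 2
        = (q₂ * r₁ / (p₁ * p₂)) * x₁ t ^ 2 - (q₂ / p₂) * x₃ t ^ 2 + x₄ t ^ 2) ∧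
    (∀ s t : ℝ,
      (r₁ * r₂ / (p₁ * p₂)) * x₁ s ^ 2 - (r₂ / p₂) * x₃ s ^ 2 + x₅ s ^ 2
        = (r₁ * r₂ / (p₁ * p₂)) * x₁ t ^ 2 - (r₂ / p₂) * x₃ t ^ 2 + x₅ t ^ 2) := by
  refine ⟨fun s t => ?_, fun s t => ?_, fun s t => ?_⟩
  · have := quad_const (-(q₁ / p₁)) 1 0 x₁ x₂ x₃ hx₁ hx₂ hx₃
      (fun u => by rw [h₁, h₂, h₃]; field_simp; ring) s t
    linear_combination this
  · have := quad_const (q₂ * r₁ / (p₁ * p₂)) (-(q₂ / p₂)) 1 x₁ x₃ x₄ hx₁ hx₃ hx₄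
      (fun u => by rw [h₁, h₃, h₄]; field_simp; ring) s t
    linear_combination this
  · have := quad_const (r₁ * r₂ / (p₁ * p₂)) (-(r₂ / p₂)) 1 x₁ x₃ x₅ hx₁ hx₃ hx₅
      (fun u => by rw [h₁, h₃, h₅]; field_simp; ring) s t
    linear_combination this
end

section
/- Let K ≥ 1, M = 2K + 1, and let p, q, r : Fin K → ℝ. Let x : ℝ → (Fin M → ℝ) be differentiable and satisfy the sparse GLOM without linear feedback: for each mode i, xᵢ' equals the sum over those k ∈ {1,…,K} with i ∈ {2k−1, 2k, 2k+1} of, respectively, p(k)·x_{2k}·x_{2k+1} (if i = 2k−1), q(k)·x_{2k+1}·x_{2k−1} (if i = 2k), and r(k)·x_{2k−1}·x_{2k} (if i = 2k+1). If d ∈ ℝ^M satisfies p(k)·d(2k−1) + q(k)·d(2k) + r(k)·d(2k+1) = 0 for all k, then t ↦ (1/2)Σᵢ dᵢ·xᵢ(t)² is constant on ℝ. -/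
/-- The index of the `o`-th mode (o = 0, 1, 2) of the `k`-th gyrostat in a sparse GLOM
with `K` gyrostats and `2K + 1` modes. -/
def midx {K : ℕ} (k : Fin K) (o : Fin 3) : Fin (2 * K + 1) :=
  ⟨2 * k.val + o.val, by have hk := k.isLt; have ho := o.isLt; omega⟩

/-- for a sparse GLOM without linear feedback, any coefficient vector d
satisfying the K linear relations yields a conserved quadratic form (1/2)Σ dᵢxᵢ². -/
theorem sparse_glom_quadratic_invariant (K : ℕ) (hK : 1 ≤ K)
    (p q r : Fin K → ℝ)
    (x : ℝ → Fin (2 * K + 1) → ℝ)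
    (hx : ∀ i, Differentiable ℝ (fun t => x t i))
    (hode : ∀ (t : ℝ) (i : Fin (2 * K + 1)),
      deriv (fun s => x s i) t =
        ∑ k : Fin K,
          ((if i = midx k 0 then p k * x t (midx k 1) * x t (midx k 2) else 0)
            + (if i = midx k 1 then q k * x t (midx k 2) * x t (midx k 0) else 0)
            + (if i = midx k 2 then r k * x t (midx k 0) * x t (midx k 1) else 0)))
    (d : Fin (2 * K + 1) → ℝ)
    (hd : ∀ k : Fin K,
      p k * d (midx k 0) + q k * d (midx k 1) + r k * d (midx k 2) = 0) :
    ∀ s t : ℝ,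
      (1 / 2) * ∑ i, d i * x s i ^ 2 = (1 / 2) * ∑ i, d i * x t i ^ 2 := by
  have key : ∀ t, HasDerivAt (fun t => ∑ i, d i * x t i ^ 2) 0 t := by
    intro t
    have h1 : HasDerivAt (fun t => ∑ i, d i * x t i ^ 2)
        (∑ i, d i * (2 * x t i * deriv (fun s => x s i) t)) t := by
      apply HasDerivAt.fun_sum
      intro i _
      have h := (((hx i) t).hasDerivAt.pow 2).const_mul (d i)
      simpa using h
    have h2 : ∑ i, d i * (2 * x t i * deriv (fun s => x s i) t) = 0 := by
      simp only [hode, Finset.mul_sum]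
      rw [Finset.sum_comm]
      apply Finset.sum_eq_zero
      intro k _
      simp only [mul_add, mul_ite, mul_zero, Finset.sum_add_distrib, Finset.sum_ite_eq',
        Finset.sum_ite_eq, Finset.mem_univ, if_true]
      linear_combination (2 * x t (midx k 0) * x t (midx k 1) * x t (midx k 2)) * hd k
    rwa [h2] at h1
  intro s t
  congr 1
  exact is_const_of_deriv_eq_zero (fun t => (key t).differentiableAt) (fun t => (key t).deriv) s t
end

section
/- Let J : ℝ⁴ → Matrix (Fin 4) (Fin 4) ℝ be the Model 1 symplectic matrix: J(x)₁₂ = −c₁, J(x)₁₃ = p₁x₂ + b₁, J(x)₁₄ = 0, J(x)₂₃ = q₁x₁ − a₁ − c₂, J(x)₂₄ = p₂x₃ + b₂, J(x)₃₄ = q₂x₂ − a₂, with zero diagonal and J(x)ⱼᵢ = −J(x)ᵢⱼ. If p₁p₂ = 0, p₂b₁ = 0, and q₂c₁ + p₁b₂ = 0, then J satisfies the Jacobi identity: for all i, j, k ∈ Fin 4 and all x ∈ ℝ⁴, Σₘ [J(x)ᵢₘ ∂J(·)ⱼₖ/∂xₘ(x) + J(x)ⱼₘ ∂J(·)ₖᵢ/∂xₘ(x)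 + J(x)ₖₘ ∂J(·)ᵢⱼ/∂xₘ(x)] = 0, so Model 1 is then a non-canonical Hamiltonian system with Hamiltonian H = (1/2)Σᵢxᵢ². -/
/-- The symplectic matrix of Model 1 (M = 4 modes, K = 2 gyrostats). -/
def model1J (a₁ b₁ c₁ p₁ q₁ a₂ b₂ c₂ p₂ q₂ : ℝ) (x : Fin 4 → ℝ) :
    Matrix (Fin 4) (Fin 4) ℝ :=
  !![0, -c₁, p₁ * x 1 + b₁, 0;
     c₁, 0, q₁ * x 0 - a₁ - c₂, p₂ * x 2 + b₂;
     -(p₁ * x 1 + b₁), -(q₁ * x 0 - a₁ - c₂), 0, q₂ * x 1 - a₂;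
     0, -(p₂ * x 2 + b₂), -(q₂ * x 1 - a₂), 0]

/-- The derivative of every entry of `model1J` in direction `v` is obtained from the affine
structure: it is the entry with all constants set to zero, evaluated at `v`. -/
lemma model1J_fderiv (a₁ b₁ c₁ p₁ q₁ a₂ b₂ c₂ p₂ q₂ : ℝ) (j k : Fin 4) (x v : Fin 4 → ℝ) :
    fderiv ℝ (fun y => model1J a₁ b₁ c₁ p₁ q₁ a₂ b₂ c₂ p₂ q₂ y j k) x v
      = model1J 0 0 0 p₁ q₁ 0 0 0 p₂ q₂ v j k := by
  have key : ∀ (r s : ℝ) (n : Fin 4),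
      HasFDerivAt (fun y : Fin 4 → ℝ => r * y n + s)
        (r • (ContinuousLinearMap.proj n : (Fin 4 → ℝ) →L[ℝ] ℝ)) x := fun r s n =>
    (((ContinuousLinearMap.proj n : (Fin 4 → ℝ) →L[ℝ] ℝ).hasFDerivAt).const_mul r).add_const s
  have aff : ∀ (f : (Fin 4 → ℝ) → ℝ) (r s : ℝ) (n : Fin 4), (∀ y, f y = r * y n + s) →
      fderiv ℝ f x v = r * v n := by
    intro f r s n hf
    rw [funext hf, (key r s n).fderiv]
    simp
  have fin : ∃ (r s : ℝ) (n : Fin 4),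
      (∀ y, model1J a₁ b₁ c₁ p₁ q₁ a₂ b₂ c₂ p₂ q₂ y j k = r * y n + s) ∧
      model1J 0 0 0 p₁ q₁ 0 0 0 p₂ q₂ v j k = r * v n := by
    fin_cases j <;> fin_cases k <;> simp [model1J]
    · exact ⟨0, 0, 0, by simp, by simp⟩
    · exact ⟨0, -c₁, 0, by simp, by simp⟩
    · exact ⟨p₁, b₁, 1, by simp, by simp⟩
    · exact ⟨0, 0, 0, by simp, by simp⟩
    · exact ⟨0, c₁, 0, by simp, by simp⟩
    · exact ⟨0, 0, 0, by simp, by simp⟩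
    · exact ⟨q₁, -a₁ - c₂, 0, fun y => by ring, by ring⟩
    · exact ⟨p₂, b₂, 2, by simp, by simp⟩
    · exact ⟨-p₁, -b₁, 1, fun y => by ring, by ring⟩
    · exact ⟨-q₁, a₁ + c₂, 0, fun y => by ring, by ring⟩
    · exact ⟨0, 0, 0, by simp, by simp⟩
    · exact ⟨q₂, -a₂, 1, fun y => by ring, by ring⟩
    · exact ⟨0, 0, 0, by simp, by simp⟩
    · exact ⟨-p₂, -b₂, 2, fun y => by ring, by ring⟩
    · exact ⟨-q₂, a₂, 1, fun y => by ring, by ring⟩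
    · exact ⟨0, 0, 0, by simp, by simp⟩
  obtain ⟨r, s, n, h, h'⟩ := fin
  rw [h', aff _ r s n h]

/-- under the constraints p₁p₂ = 0, p₂b₁ = 0 and q₂c₁ + p₁b₂ = 0, the
Model 1 symplectic matrix satisfies the Jacobi identity. -/
theorem model1J_jacobi_identity (a₁ b₁ c₁ p₁ q₁ a₂ b₂ c₂ p₂ q₂ : ℝ)
    (h₁ : p₁ * p₂ = 0) (h₂ : p₂ * b₁ = 0) (h₃ : q₂ * c₁ + p₁ * b₂ = 0) :
    ∀ (i j k : Fin 4) (x : Fin 4 → ℝ),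
      ∑ m : Fin 4,
        (model1J a₁ b₁ c₁ p₁ q₁ a₂ b₂ c₂ p₂ q₂ x i m
            * fderiv ℝ (fun y => model1J a₁ b₁ c₁ p₁ q₁ a₂ b₂ c₂ p₂ q₂ y j k) x
                (Pi.single m 1)
          + model1J a₁ b₁ c₁ p₁ q₁ a₂ b₂ c₂ p₂ q₂ x j m
            * fderiv ℝ (fun y => model1J a₁ b₁ c₁ p₁ q₁ a₂ b₂ c₂ p₂ q₂ y k i) x
                (Pi.single m 1)
          + model1J a₁ b₁ c₁ p₁ q₁ a₂ b₂ c₂ p₂ q₂ x k m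
            * fderiv ℝ (fun y => model1J a₁ b₁ c₁ p₁ q₁ a₂ b₂ c₂ p₂ q₂ y i j) x
                (Pi.single m 1)) = 0 := by
  intro i j k x
  simp only [model1J_fderiv, Fin.sum_univ_four]
  fin_cases i <;> fin_cases j <;> fin_cases k <;> simp [model1J, Pi.single_apply] <;> grind
end

section
/- Let J : ℝ⁵ → Matrix (Fin 5) (Fin 5) ℝ be the Model 2 symplectic matrix: J(x)₁₂ = −c₁, J(x)₁₃ = p₁x₂ + b₁, J(x)₂₃ = q₁x₁ − a₁, J(x)₃₄ = −c₂, J(x)₃₅ = p₂x₄ + b₂, J(x)₄₅ = q₂x₃ − a₂, all other entries above the diagonal zero, zero diagonal, and J(x)ⱼᵢ = −J(x)ᵢⱼ. If q₂ = 0, then J satisfies the Jacobi identity: for all i, j, k ∈ Fin 5 and all x ∈ ℝ⁵, Σₘ [J(x)ᵢₘ ∂J(·)ⱼₖ/∂xₘ(x) + J(x)ⱼₘ ∂J(·)ₖᵢ/∂xₘ(x) + J(x)ₖₘ ∂J(·)ᵢⱼ/∂xₘ(x)] = 0, so Model 2 with q₂ = 0 is a non-canonical Hamiltonian system with Hamiltonian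 H = (1/2)Σᵢxᵢ². -/
/-- The symplectic matrix of Model 2 (M = 5 modes, K = 2 gyrostats). -/
def model2J (a₁ b₁ c₁ p₁ q₁ a₂ b₂ c₂ p₂ q₂ : ℝ) (x : Fin 5 → ℝ) :
    Matrix (Fin 5) (Fin 5) ℝ :=
  !![0, -c₁, p₁ * x 1 + b₁, 0, 0;
     c₁, 0, q₁ * x 0 - a₁, 0, 0;
     -(p₁ * x 1 + b₁), -(q₁ * x 0 - a₁), 0, -c₂, p₂ * x 3 + b₂;
     0, 0, c₂, 0, q₂ * x 2 - a₂;
     0, 0, -(p₂ * x 3 + b₂), -(q₂ * x 2 - a₂), 0]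

/-- The derivative of the entries of the matrix in the direction `v` (for `q₂ = 0`). -/
theorem model2J_fderiv (a₁ b₁ c₁ p₁ q₁ a₂ b₂ c₂ p₂ : ℝ) (j k : Fin 5) (x v : Fin 5 → ℝ) :
    fderiv ℝ (fun y => model2J a₁ b₁ c₁ p₁ q₁ a₂ b₂ c₂ p₂ 0 y j k) x v
      = model2J 0 0 0 p₁ q₁ 0 0 0 p₂ 0 v j k := by
  have hx : ∀ (i : Fin 5) (p : ℝ),
      fderiv ℝ (fun y : Fin 5 → ℝ => p * y i) x v = p * v i := by
    intro i p
    have h : HasFDerivAt (fun y : Fin 5 → ℝ => p * y i)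
        (p • (ContinuousLinearMap.proj i : (Fin 5 → ℝ) →L[ℝ] ℝ)) x :=
      (hasFDerivAt_apply i x).const_mul p
    rw [h.fderiv]
    simp
  fin_cases j <;> fin_cases k <;>
    simp [model2J, hx, fderiv_add_const, fderiv_sub_const,
      -neg_add_rev, -neg_sub, fderiv_fun_neg]

set_option maxHeartbeats 4000000 in
/-- if q₂ = 0, the Model 2 symplectic matrix satisfies the Jacobi identity. -/
theorem model2J_jacobi_identity (a₁ b₁ c₁ p₁ q₁ a₂ b₂ c₂ p₂ q₂ : ℝ)
    (hq₂ : q₂ = 0) :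
    ∀ (i j k : Fin 5) (x : Fin 5 → ℝ),
      ∑ m : Fin 5,
        (model2J a₁ b₁ c₁ p₁ q₁ a₂ b₂ c₂ p₂ q₂ x i m
            * fderiv ℝ (fun y => model2J a₁ b₁ c₁ p₁ q₁ a₂ b₂ c₂ p₂ q₂ y j k) x
                (Pi.single m 1)
          + model2J a₁ b₁ c₁ p₁ q₁ a₂ b₂ c₂ p₂ q₂ x j m
            * fderiv ℝ (fun y => model2J a₁ b₁ c₁ p₁ q₁ a₂ b₂ c₂ p₂ q₂ y k i) x
                (Pi.single m 1)
          + model2J a₁ b₁ c₁ p₁ q₁ a₂ b₂ c₂ p₂ q₂ x k m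
            * fderiv ℝ (fun y => model2J a₁ b₁ c₁ p₁ q₁ a₂ b₂ c₂ p₂ q₂ y i j) x
                (Pi.single m 1)) = 0 := by
  subst hq₂
  intro i j k x
  simp only [model2J_fderiv, Fin.sum_univ_five]
  fin_cases i <;> fin_cases j <;> fin_cases k <;> simp [model2J] <;> ring
end

section
/- If x₁, x₂, x₃, x₄, x₅ : ℝ → ℝ are differentiable and satisfy for all t the Hamiltonian subclass of Model 2 with q₂ = 0: x₁' = p₁x₂x₃ + b₁x₃ − c₁x₂; x₂' = q₁x₃x₁ + c₁x₁ − a₁x₃; x₃' = −(p₁+q₁)x₁x₂ + a₁x₂ − b₁x₁ + p₂x₄x₅ + b₂x₅ − c₂x₄; x₄' = c₂x₃ − a₂x₅; x₅' = −p₂x₃x₄ + a₂x₄ − b₂x₃, then the Casimir function t ↦ −(a₂q₁/2)x₁² + (a₂p₁/2)x₂² + (c₁p₂/2)x₄² + a₁a₂x₁ + a₂b₁x₂ + a₂c₁x₃ + c₁b₂x₄ + c₁c₂x₅ is constant on ℝ. -/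
/-- the Casimir of the Hamiltonian subclass of Model 2 (q₂ = 0) is conserved. -/
theorem model2_hamiltonian_casimir_conserved
    (a₁ b₁ c₁ p₁ q₁ a₂ b₂ c₂ p₂ : ℝ)
    (x₁ x₂ x₃ x₄ x₅ : ℝ → ℝ)
    (hx₁ : Differentiable ℝ x₁) (hx₂ : Differentiable ℝ x₂)
    (hx₃ : Differentiable ℝ x₃) (hx₄ : Differentiable ℝ x₄)
    (hx₅ : Differentiable ℝ x₅)
    (h₁ : ∀ t, deriv x₁ t = p₁ * x₂ t * x₃ t + b₁ * x₃ t - c₁ * x₂ t)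
    (h₂ : ∀ t, deriv x₂ t = q₁ * x₃ t * x₁ t + c₁ * x₁ t - a₁ * x₃ t)
    (h₃ : ∀ t, deriv x₃ t = -(p₁ + q₁) * x₁ t * x₂ t + a₁ * x₂ t - b₁ * x₁ t
      + p₂ * x₄ t * x₅ t + b₂ * x₅ t - c₂ * x₄ t)
    (h₄ : ∀ t, deriv x₄ t = c₂ * x₃ t - a₂ * x₅ t)
    (h₅ : ∀ t, deriv x₅ t = -p₂ * x₃ t * x₄ t + a₂ * x₄ t - b₂ * x₃ t) :
    ∀ s t : ℝ,
      -(a₂ * q₁ / 2) * x₁ s ^ 2 + (a₂ * p₁ / 2) * x₂ s ^ 2 + (c₁ * p₂ / 2) * x₄ s ^ 2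
          + a₁ * a₂ * x₁ s + a₂ * b₁ * x₂ s + a₂ * c₁ * x₃ s
          + c₁ * b₂ * x₄ s + c₁ * c₂ * x₅ s
        = -(a₂ * q₁ / 2) * x₁ t ^ 2 + (a₂ * p₁ / 2) * x₂ t ^ 2 + (c₁ * p₂ / 2) * x₄ t ^ 2
          + a₁ * a₂ * x₁ t + a₂ * b₁ * x₂ t + a₂ * c₁ * x₃ t
          + c₁ * b₂ * x₄ t + c₁ * c₂ * x₅ t := by
  intro s t
  have key : ∀ u, HasDerivAt (fun u => -(a₂ * q₁ / 2) * x₁ u ^ 2 + (a₂ * p₁ / 2) * x₂ u ^ 2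
      + (c₁ * p₂ / 2) * x₄ u ^ 2 + a₁ * a₂ * x₁ u + a₂ * b₁ * x₂ u + a₂ * c₁ * x₃ u
      + c₁ * b₂ * x₄ u + c₁ * c₂ * x₅ u) 0 u := by
    intro u
    have d₁ := (hx₁ u).hasDerivAt
    have d₂ := (hx₂ u).hasDerivAt
    have d₃ := (hx₃ u).hasDerivAt
    have d₄ := (hx₄ u).hasDerivAt
    have d₅ := (hx₅ u).hasDerivAt
    rw [h₁] at d₁
    rw [h₂] at d₂
    rw [h₃] at d₃
    rw [h₄] at d₄
    rw [h₅] at d₅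
    refine ((((((((d₁.fun_pow 2).const_mul (-(a₂ * q₁ / 2))).fun_add
      ((d₂.fun_pow 2).const_mul (a₂ * p₁ / 2))).fun_add
      ((d₄.fun_pow 2).const_mul (c₁ * p₂ / 2))).fun_add
      (d₁.const_mul (a₁ * a₂))).fun_add (d₂.const_mul (a₂ * b₁))).fun_add
      (d₃.const_mul (a₂ * c₁))).fun_add (d₄.const_mul (c₁ * b₂))).fun_add
      (d₅.const_mul (c₁ * c₂)) |>.congr_deriv ?_
    push_cast
    ring
  exact is_const_of_deriv_eq_zero (fun u => (key u).differentiableAt)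
    (fun u => (key u).deriv) s t
end

section
/- If x₁, x₂, x₃, x₄ : ℝ → ℝ are differentiable and satisfy for all t the Hamiltonian subclass of Model 1 with p₂ = c₁ = b₂ = 0: x₁' = p₁x₂x₃ + b₁x₃; x₂' = q₁x₃x₁ − a₁x₃ − c₂x₃; x₃' = r₁x₁x₂ + a₁x₂ − b₁x₁ + q₂x₄x₂ + c₂x₂ − a₂x₄; x₄' = r₂x₂x₃ + a₂x₃, then the Casimir function t ↦ −(q₁/2)x₁(t)² + (p₁/2)x₂(t)² + (a₁ + c₂)x₁(t) + b₁x₂(t) is constant on ℝ. -/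
/-- the Casimir of the Hamiltonian subclass of Model 1 with
p₂ = c₁ = b₂ = 0 is conserved. -/
theorem model1_hamiltonian_casimir_conserved
    (a₁ b₁ p₁ q₁ r₁ a₂ c₂ q₂ r₂ : ℝ)
    (x₁ x₂ x₃ x₄ : ℝ → ℝ)
    (hx₁ : Differentiable ℝ x₁) (hx₂ : Differentiable ℝ x₂)
    (hx₃ : Differentiable ℝ x₃) (hx₄ : Differentiable ℝ x₄)
    (h₁ : ∀ t, deriv x₁ t = p₁ * x₂ t * x₃ t + b₁ * x₃ t)
    (h₂ : ∀ t, deriv x₂ t = q₁ * x₃ t * x₁ t - a₁ * x₃ t - c₂ * x₃ t)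
    (h₃ : ∀ t, deriv x₃ t = r₁ * x₁ t * x₂ t + a₁ * x₂ t - b₁ * x₁ t
      + q₂ * x₄ t * x₂ t + c₂ * x₂ t - a₂ * x₄ t)
    (h₄ : ∀ t, deriv x₄ t = r₂ * x₂ t * x₃ t + a₂ * x₃ t) :
    ∀ s t : ℝ,
      -(q₁ / 2) * x₁ s ^ 2 + (p₁ / 2) * x₂ s ^ 2 + (a₁ + c₂) * x₁ s + b₁ * x₂ s
        = -(q₁ / 2) * x₁ t ^ 2 + (p₁ / 2) * x₂ t ^ 2 + (a₁ + c₂) * x₁ t + b₁ * x₂ t := by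
  have key : ∀ t, HasDerivAt (fun t => -(q₁ / 2) * x₁ t ^ 2 + (p₁ / 2) * x₂ t ^ 2
      + (a₁ + c₂) * x₁ t + b₁ * x₂ t) 0 t := by
    intro t
    have d₁ := (hx₁ t).hasDerivAt
    have d₂ := (hx₂ t).hasDerivAt
    have d := ((((d₁.fun_pow 2).const_mul (-(q₁ / 2))).fun_add
      ((d₂.fun_pow 2).const_mul (p₁ / 2))).fun_add (d₁.const_mul (a₁ + c₂))).fun_add
      (d₂.const_mul b₁)
    refine d.congr_deriv ?_
    rw [h₁, h₂]
    push_cast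
    ring
  exact fun s t => is_const_of_deriv_eq_zero (fun t => (key t).differentiableAt)
    (fun t => (key t).deriv) s t
end
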